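/- arXiv:2603.17288 — 8 statements merged into one kernel-verified Lean document; each statement's English description precedes it below -/
import Mathlib

section
/- Under the Krawczyk hypothesis, the system F(y) = 0 has exactly one solution x* in the box x + rB; that is, there exists a unique x* ∈ ℂⁿ with ‖x* − x‖ ≤ r and F(x*) = 0. -/
/-- The real sup-norm on `ℂⁿ`: `‖v‖ = max_i max(|Re vᵢ|, |Im vᵢ|)`. -/
noncomputable def boxNorm {n : ℕ} (v : Fin n → ℂ) : ℝ :=
  ⨆ i : Fin n, max |(v i).re| |(v i).im|

/-- A Krawczyk-type fixed point theorem: if `G x - x + r • G' y b` has norm at most `r * ρ` for all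
`y` in the closed ball of radius `r` around `x` and all `b` in the unit ball, then `G` has exactly
one fixed point in that closed ball. -/
theorem existsUnique_isFixedPt_of_krawczyk {E : Type*} [NormedAddCommGroup E] [NormedSpace ℝ E]
    [CompleteSpace E] {G : E → E} {G' : E → E →L[ℝ] E} {x : E} {r ρ : ℝ} (hr : 0 < r)
    (hρ0 : 0 ≤ ρ) (hρ1 : ρ < 1)
    (hG : ∀ y, ‖y - x‖ ≤ r → HasFDerivAt G (G' y) y)
    (hK : ∀ y, ‖y - x‖ ≤ r → ∀ b, ‖b‖ ≤ 1 → ‖G x - x + r • G' y b‖ ≤ r * ρ) :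
    ∃! z, ‖z - x‖ ≤ r ∧ G z = z := by
  have hmem : ∀ y, y ∈ Metric.closedBall x r ↔ ‖y - x‖ ≤ r := fun y => mem_closedBall_iff_norm
  have hG'ball : ∀ y, ‖y - x‖ ≤ r → ∀ b, ‖b‖ ≤ 1 → ‖G' y b‖ ≤ ρ := by
    intro y hy b hb
    have h₁ := hK y hy b hb
    have h₂ := hK y hy (-b) (by rwa [norm_neg])
    have h₃ := norm_sub_le (G x - x + r • G' y b) (G x - x + r • G' y (-b))
    have h₄ : G x - x + r • G' y b - (G x - x + r • G' y (-b)) = (2 * r) • G' y b := by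
      rw [map_neg]; module
    rw [h₄, norm_smul, Real.norm_of_nonneg (by positivity)] at h₃
    nlinarith
  have hG'norm : ∀ y, ‖y - x‖ ≤ r → ‖G' y‖ ≤ ρ := by
    intro y hy
    refine ContinuousLinearMap.opNorm_le_of_unit_norm hρ0 fun b hb => hG'ball y hy b hb.le
  have hLip : LipschitzOnWith (NNReal.mk ρ hρ0) G (Metric.closedBall x r) :=
    (convex_closedBall x r).lipschitzOnWith_of_nnnorm_hasFDerivWithin_le
      (fun y hy => (hG y ((hmem y).1 hy)).hasFDerivWithinAt)
      (fun y hy => hG'norm y ((hmem y).1 hy))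
  have hmaps : Set.MapsTo G (Metric.closedBall x r) (Metric.closedBall x r) := by
    intro y hy
    rw [hmem] at hy ⊢
    have hseg : ∀ t ∈ Set.Icc (0 : ℝ) 1, ‖x + t • (y - x) - x‖ ≤ r := by
      intro t ht
      rw [add_sub_cancel_left, norm_smul, Real.norm_of_nonneg ht.1]
      nlinarith [ht.2, norm_nonneg (y - x)]
    have hderiv : ∀ t ∈ Set.Icc (0 : ℝ) 1,
        HasDerivWithinAt (fun t : ℝ => t • (G x - x) + G (x + t • (y - x)))
          (G x - x + G' (x + t • (y - x)) (y - x)) (Set.Icc 0 1) t := by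
      intro t ht
      have h₁ : HasDerivAt (fun t : ℝ => x + t • (y - x)) (y - x) t := by
        simpa using ((hasDerivAt_id t).smul_const (y - x)).const_add x
      have h₂ : HasDerivAt (fun t : ℝ => t • (G x - x)) (G x - x) t := by
        simpa using (hasDerivAt_id t).smul_const (G x - x)
      exact (h₂.add ((hG _ (hseg t ht)).comp_hasDerivAt t h₁)).hasDerivWithinAt
    have hbound : ∀ t ∈ Set.Ico (0 : ℝ) 1,
        ‖G x - x + G' (x + t • (y - x)) (y - x)‖ ≤ r * ρ := by
      intro t ht
      have hb : ‖r⁻¹ • (y - x)‖ ≤ 1 := by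
        rw [norm_smul, norm_inv, Real.norm_of_nonneg hr.le, inv_mul_le_iff₀ hr, mul_one]
        exact hy
      simpa [map_smul, smul_smul, hr.ne'] using hK _ (hseg t ⟨ht.1, ht.2.le⟩) _ hb
    have h := norm_image_sub_le_of_norm_deriv_le_segment_01' hderiv hbound
    have h₀ : (1 : ℝ) • (G x - x) + G (x + (1 : ℝ) • (y - x))
        - ((0 : ℝ) • (G x - x) + G (x + (0 : ℝ) • (y - x))) = G y - x := by
      rw [one_smul, one_smul, zero_smul, zero_smul, add_zero, add_sub_cancel]; abel
    rw [h₀] at h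
    nlinarith
  have hcontr : ContractingWith (NNReal.mk ρ hρ0) (hmaps.restrict G _ _) :=
    ⟨by exact_mod_cast hρ1, hLip.mapsToRestrict hmaps⟩
  obtain ⟨z, hz, hfix, -⟩ := hcontr.exists_fixedPoint' Metric.isClosed_closedBall.isComplete hmaps
    (Metric.mem_closedBall_self hr.le) (edist_ne_top _ _)
  refine ⟨z, ⟨(hmem z).1 hz, hfix⟩, fun w ⟨hw, hwfix⟩ => ?_⟩
  have h := hLip.dist_le_mul w ((hmem w).2 hw) z hz
  rw [hwfix, hfix.eq, NNReal.coe_mk] at h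
  refine dist_le_zero.1 ?_
  nlinarith [dist_nonneg (x := w) (y := z)]

/-- The real coordinates of a complex vector, as a continuous linear equivalence onto a space whose
norm is the real sup-norm. -/
noncomputable def complexPiEquivRealProd (n : ℕ) : (Fin n → ℂ) ≃L[ℝ] (Fin n → ℝ × ℝ) :=
  ContinuousLinearEquiv.piCongrRight fun _ => Complex.equivRealProdCLM

theorem norm_complexPiEquivRealProd {n : ℕ} (v : Fin n → ℂ) :
    ‖complexPiEquivRealProd n v‖ = boxNorm v := by
  have hcoord : ∀ i, ‖complexPiEquivRealProd n v i‖ = max |(v i).re| |(v i).im| := fun _ => rfl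
  have hnonneg : ∀ i, 0 ≤ max |(v i).re| |(v i).im| := fun i =>
    (abs_nonneg _).trans (le_max_left _ _)
  apply le_antisymm
  · refine (pi_norm_le_iff_of_nonneg (Real.iSup_nonneg hnonneg)).2 fun i => ?_
    rw [hcoord]
    exact le_ciSup (f := fun i => max |(v i).re| |(v i).im|) (Set.finite_range _).bddAbove i
  · refine Real.iSup_le (fun i => ?_) (norm_nonneg _)
    rw [← hcoord]
    exact norm_le_pi_norm _ i

/-- Under the Krawczyk hypothesis, `F(y) = 0` has exactly one solution `x*` in the
box `x + rB`. -/
theorem krawczyk_existsUnique_solution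
    {n : ℕ} (hn : 1 ≤ n)
    (F : (Fin n → ℂ) → (Fin n → ℂ)) (x : Fin n → ℂ) (r : ℝ) (hr : 0 < r)
    (U : Set (Fin n → ℂ)) (hU : IsOpen U)
    (hbox : {y : Fin n → ℂ | boxNorm (y - x) ≤ r} ⊆ U)
    (hF : DifferentiableOn ℂ F U)
    (A : Matrix (Fin n) (Fin n) ℂ) (hA : IsUnit A.det)
    (ρ : ℝ) (hρ0 : 0 < ρ) (hρ1 : ρ < 1)
    (hK : ∀ y : Fin n → ℂ, boxNorm (y - x) ≤ r →
      ∀ b : Fin n → ℂ, boxNorm b ≤ 1 →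
        boxNorm (-(A.mulVec (F x)) + r • (b - A.mulVec (fderiv ℂ F y b))) ≤ r * ρ) :
    ∃! xs : Fin n → ℂ, boxNorm (xs - x) ≤ r ∧ F xs = 0 := by
  set e := complexPiEquivRealProd n
  have hnorm : ∀ v, ‖e v‖ = boxNorm v := norm_complexPiEquivRealProd
  have hnorm_symm : ∀ w, ‖w‖ = boxNorm (e.symm w) := fun w => by
    rw [← hnorm, e.apply_symm_apply]
  let N : (Fin n → ℂ) → (Fin n → ℂ) := fun y => y - A.mulVec (F y)
  let M : (Fin n → ℂ) →L[ℂ] (Fin n → ℂ) := A.mulVecLin.toContinuousLinearMap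
  let N' : (Fin n → ℂ) → (Fin n → ℂ) →L[ℂ] (Fin n → ℂ) := fun y =>
    ContinuousLinearMap.id ℂ _ - M.comp (fderiv ℂ F y)
  have hN : ∀ y, boxNorm (y - x) ≤ r → HasFDerivAt N (N' y) y := fun y hy =>
    (hasFDerivAt_id y).sub (M.hasFDerivAt.comp y
      (hF.differentiableAt (hU.mem_nhds (hbox hy))).hasFDerivAt)
  have hfixed : ∀ y, N y = y ↔ F y = 0 := by
    intro y
    refine sub_eq_self.trans ⟨fun h => ?_, fun h => by rw [h, Matrix.mulVec_zero]⟩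
    exact Matrix.eq_zero_of_mulVec_eq_zero hA.ne_zero h
  have hbox_symm : ∀ w, ‖w - e x‖ ≤ r ↔ boxNorm (e.symm w - x) ≤ r := fun w => by
    rw [hnorm_symm, map_sub, e.symm_apply_apply]
  have key : ∃! w, ‖w - e x‖ ≤ r ∧ e (N (e.symm w)) = w := by
    refine existsUnique_isFixedPt_of_krawczyk (G := fun w => e (N (e.symm w)))
      (G' := fun w => (e : (Fin n → ℂ) →L[ℝ] (Fin n → ℝ × ℝ)).comp
        (((N' (e.symm w)).restrictScalars ℝ).comp (e.symm : (Fin n → ℝ × ℝ) →L[ℝ] (Fin n → ℂ))))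
      hr hρ0.le hρ1 (fun w hw => ?_) (fun w hw b hb => ?_)
    · exact e.hasFDerivAt.comp w
        (((hN _ ((hbox_symm w).1 hw)).restrictScalars ℝ).comp w e.symm.hasFDerivAt)
    · have h := hK _ ((hbox_symm w).1 hw) (e.symm b) (by rwa [← hnorm_symm])
      rw [← hnorm] at h
      refine (congrArg norm ?_).trans_le h
      simp [N, N', M]
  obtain ⟨w, ⟨hw, hwfix⟩, huniq⟩ := key
  refine ⟨e.symm w, ⟨(hbox_symm w).1 hw, (hfixed _).1 ?_⟩, fun y ⟨hy, hFy⟩ => ?_⟩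
  · rw [e.eq_symm_apply, hwfix]
  · rw [e.eq_symm_apply]
    refine huniq _ ⟨(hbox_symm _).2 (by rwa [e.symm_apply_apply]), ?_⟩
    rw [e.symm_apply_apply, (hfixed y).2 hFy]
end

section
/- Under the Krawczyk hypothesis, the unique solution x* of F(y) = 0 in the box x + rB satisfies ‖x − x*‖ ≤ rρ. -/
theorem boxNorm_le_iff {n : ℕ} {v : Fin n → ℂ} {c : ℝ} (hc : 0 ≤ c) :
    boxNorm v ≤ c ↔ ∀ i, |(v i).re| ≤ c ∧ |(v i).im| ≤ c := by
  constructor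
  · intro h i
    exact max_le_iff.mp ((le_ciSup (Set.finite_range _).bddAbove i).trans h)
  · intro h
    exact Real.iSup_le (fun i => max_le (h i).1 (h i).2) hc

theorem boxNorm_smul {n : ℕ} (t : ℝ) (v : Fin n → ℂ) :
    boxNorm (t • v) = |t| * boxNorm v := by
  simp only [boxNorm, Real.mul_iSup_of_nonneg (abs_nonneg t), mul_max_of_nonneg _ _ (abs_nonneg t),
    Pi.smul_apply, Complex.smul_re, Complex.smul_im, smul_eq_mul, abs_mul]

theorem boxNorm_sub_rev {n : ℕ} (v w : Fin n → ℂ) : boxNorm (v - w) = boxNorm (w - v) := by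
  rw [← neg_sub w v, ← neg_one_smul ℝ (w - v), boxNorm_smul, abs_neg, abs_one, one_mul]

/-- Mean value theorem for a real functional of the Newton-type map `y ↦ y - x - A F(y)`
along the segment from `x` to a zero `x + d` of `F`. -/
theorem exists_segment_functional_eq {n : ℕ} {F : (Fin n → ℂ) → (Fin n → ℂ)} {x d : Fin n → ℂ}
    (hF : ∀ t ∈ Set.Icc (0 : ℝ) 1, DifferentiableAt ℂ F (x + t • d)) (hzero : F (x + d) = 0)
    (A : Matrix (Fin n) (Fin n) ℂ) (L : (Fin n → ℂ) →L[ℝ] ℝ) :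
    ∃ t ∈ Set.Icc (0 : ℝ) 1,
      L d = L (-(A.mulVec (F x)) + (d - A.mulVec (fderiv ℂ F (x + t • d) d))) := by
  let M : (Fin n → ℂ) →L[ℝ] (Fin n → ℂ) :=
    (LinearMap.toContinuousLinearMap (Matrix.mulVecLin A)).restrictScalars ℝ
  have hderiv : ∀ t ∈ Set.Icc (0 : ℝ) 1,
      HasDerivAt (fun t : ℝ => L (t • d - A.mulVec (F (x + t • d))))
        (L (d - A.mulVec (fderiv ℂ F (x + t • d) d))) t := by
    intro t ht
    have hline : HasDerivAt (fun t : ℝ => t • d) d t := by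
      simpa using (hasDerivAt_id t).smul_const d
    have hFline : HasDerivAt (fun t : ℝ => F (x + t • d)) (fderiv ℂ F (x + t • d) d) t :=
      HasFDerivAt.comp_hasDerivAt (f := fun t : ℝ => x + t • d) t
        ((hF t ht).hasFDerivAt.restrictScalars ℝ) (hline.const_add x)
    exact L.hasFDerivAt.comp_hasDerivAt t (hline.sub (M.hasFDerivAt.comp_hasDerivAt t hFline))
  obtain ⟨t, ht, heq⟩ := exists_hasDerivAt_eq_slope _ _ zero_lt_one
    (fun t ht => (hderiv t ht).continuousAt.continuousWithinAt)
    (fun t ht => hderiv t (Set.Ioo_subset_Icc_self ht))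
  refine ⟨t, Set.Ioo_subset_Icc_self ht, ?_⟩
  rw [map_add, heq]
  simp [hzero]

/-- Under the Krawczyk hypothesis, the unique solution `x*` of `F(y) = 0` in the box
`x + rB` satisfies `‖x − x*‖ ≤ rρ`. -/
theorem krawczyk_solution_close
    {n : ℕ} (hn : 1 ≤ n)
    (F : (Fin n → ℂ) → (Fin n → ℂ)) (x : Fin n → ℂ) (r : ℝ) (hr : 0 < r)
    (U : Set (Fin n → ℂ)) (hU : IsOpen U)
    (hbox : {y : Fin n → ℂ | boxNorm (y - x) ≤ r} ⊆ U)
    (hF : DifferentiableOn ℂ F U)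
    (A : Matrix (Fin n) (Fin n) ℂ) (hA : IsUnit A.det)
    (ρ : ℝ) (hρ0 : 0 < ρ) (hρ1 : ρ < 1)
    (hK : ∀ y : Fin n → ℂ, boxNorm (y - x) ≤ r →
      ∀ b : Fin n → ℂ, boxNorm b ≤ 1 →
        boxNorm (-(A.mulVec (F x)) + r • (b - A.mulVec (fderiv ℂ F y b))) ≤ r * ρ) :
    ∀ xs : Fin n → ℂ, boxNorm (xs - x) ≤ r → F xs = 0 → boxNorm (x - xs) ≤ r * ρ := by
  intro xs hxs hzero
  obtain ⟨d, rfl⟩ : ∃ d, xs = x + d := ⟨xs - x, by abel⟩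
  rw [boxNorm_sub_rev]
  rw [add_sub_cancel_left] at hxs ⊢
  have hc : 0 ≤ r * ρ := (mul_pos hr hρ0).le
  have hmem : ∀ t ∈ Set.Icc (0 : ℝ) 1, boxNorm (x + t • d - x) ≤ r := by
    intro t ht
    rw [add_sub_cancel_left, boxNorm_smul, abs_of_nonneg ht.1]
    nlinarith [mul_le_mul_of_nonneg_left hxs ht.1, ht.2]
  have hdiff : ∀ t ∈ Set.Icc (0 : ℝ) 1, DifferentiableAt ℂ F (x + t • d) := fun t ht =>
    hF.differentiableAt (hU.mem_nhds (hbox (hmem t ht)))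
  have hunit : boxNorm (r⁻¹ • d) ≤ 1 := by
    rw [boxNorm_smul, abs_of_pos (inv_pos.mpr hr)]
    exact inv_mul_le_one_of_le₀ hxs hr.le
  have hbound : ∀ t ∈ Set.Icc (0 : ℝ) 1,
      boxNorm (-(A.mulVec (F x)) + (d - A.mulVec (fderiv ℂ F (x + t • d) d))) ≤ r * ρ := by
    intro t ht
    have h := hK _ (hmem t ht) _ hunit
    have hscale : fderiv ℂ F (x + t • d) (r⁻¹ • d) = r⁻¹ • fderiv ℂ F (x + t • d) d :=
      ((fderiv ℂ F (x + t • d)).restrictScalars ℝ).map_smul r⁻¹ d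
    rwa [hscale, Matrix.mulVec_smul, ← smul_sub, smul_inv_smul₀ hr.ne'] at h
  refine (boxNorm_le_iff hc).mpr fun i => ⟨?_, ?_⟩
  · obtain ⟨t, ht, heq⟩ := exists_segment_functional_eq hdiff hzero A
      (Complex.reCLM.comp (ContinuousLinearMap.proj i))
    change (d i).re = _ at heq
    rw [heq]
    exact ((boxNorm_le_iff hc).mp (hbound t ht) i).1
  · obtain ⟨t, ht, heq⟩ := exists_segment_functional_eq hdiff hzero A
      (Complex.imCLM.comp (ContinuousLinearMap.proj i))
    change (d i).im = _ at heq
    rw [heq]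
    exact ((boxNorm_le_iff hc).mp (hbound t ht) i).2
end

section
/- Under the Krawczyk hypothesis, the quasi-Newton map N(y) := y − A·F(y) maps the box x + rB into the smaller box x + rρB: for every y with ‖y − x‖ ≤ r one has ‖N(y) − x‖ ≤ rρ. -/
theorem boxNorm_smul_le {n : ℕ} {v : Fin n → ℂ} {c t : ℝ} (ht : 0 ≤ t) (hc : 0 ≤ c)
    (h : boxNorm v ≤ c) : boxNorm (t • v) ≤ t * c := by
  rw [boxNorm_le_iff (mul_nonneg ht hc)]
  intro i
  have hi := (boxNorm_le_iff hc).1 h i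
  simp only [Pi.smul_apply, Complex.smul_re, Complex.smul_im, smul_eq_mul, abs_mul,
    abs_of_nonneg ht]
  exact ⟨mul_le_mul_of_nonneg_left hi.1 ht, mul_le_mul_of_nonneg_left hi.2 ht⟩

/-- The mean value theorem for a real functional along the segment from `x` to `x + d`. -/
theorem exists_clm_sub_eq_fderiv_segment {E G : Type*} [NormedAddCommGroup E] [NormedSpace ℝ E]
    [NormedAddCommGroup G] [NormedSpace ℝ G] {f : E → G} {f' : E → E →L[ℝ] G} {x d : E}
    (hf : ∀ t ∈ Set.Icc (0 : ℝ) 1, HasFDerivAt f (f' (x + t • d)) (x + t • d))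
    (L : G →L[ℝ] ℝ) :
    ∃ t ∈ Set.Icc (0 : ℝ) 1, L (f (x + d)) - L (f x) = L (f' (x + t • d) d) := by
  have hderiv : ∀ t ∈ Set.Icc (0 : ℝ) 1,
      HasDerivAt (fun s : ℝ => L (f (x + s • d))) (L (f' (x + t • d) d)) t := by
    intro t ht
    have hline : HasDerivAt (fun s : ℝ => x + s • d) d t := by
      simpa using ((hasDerivAt_id t).smul_const d).const_add x
    exact L.hasFDerivAt.comp_hasDerivAt t ((hf t ht).comp_hasDerivAt t hline)
  obtain ⟨t, ht, hslope⟩ := exists_hasDerivAt_eq_slope (fun s : ℝ => L (f (x + s • d)))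
    (fun t => L (f' (x + t • d) d)) zero_lt_one
    (fun t ht => (hderiv t ht).continuousAt.continuousWithinAt)
    (fun t ht => hderiv t (Set.Ioo_subset_Icc_self ht))
  exact ⟨t, Set.Ioo_subset_Icc_self ht, by simpa using hslope.symm⟩

/-- Under the Krawczyk hypothesis, the quasi-Newton map `N(y) = y − A·F(y)` maps the
box `x + rB` into the smaller box `x + rρB`. -/
theorem krawczyk_quasiNewton_maps_into
    {n : ℕ} (hn : 1 ≤ n)
    (F : (Fin n → ℂ) → (Fin n → ℂ)) (x : Fin n → ℂ) (r : ℝ) (hr : 0 < r)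
    (U : Set (Fin n → ℂ)) (hU : IsOpen U)
    (hbox : {y : Fin n → ℂ | boxNorm (y - x) ≤ r} ⊆ U)
    (hF : DifferentiableOn ℂ F U)
    (A : Matrix (Fin n) (Fin n) ℂ) (hA : IsUnit A.det)
    (ρ : ℝ) (hρ0 : 0 < ρ) (hρ1 : ρ < 1)
    (hK : ∀ y : Fin n → ℂ, boxNorm (y - x) ≤ r →
      ∀ b : Fin n → ℂ, boxNorm b ≤ 1 →
        boxNorm (-(A.mulVec (F x)) + r • (b - A.mulVec (fderiv ℂ F y b))) ≤ r * ρ) :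
    ∀ y : Fin n → ℂ, boxNorm (y - x) ≤ r →
      boxNorm ((y - A.mulVec (F y)) - x) ≤ r * ρ := by
  intro y hy
  obtain ⟨d, rfl⟩ : ∃ d, y = x + d := ⟨y - x, by abel⟩
  rw [add_sub_cancel_left] at hy
  have hb : boxNorm (r⁻¹ • d) ≤ 1 := by
    simpa [hr.ne'] using boxNorm_smul_le (inv_nonneg.2 hr.le) hr.le hy
  have hseg : ∀ t ∈ Set.Icc (0 : ℝ) 1, boxNorm (x + t • d - x) ≤ r := fun t ht => by
    rw [add_sub_cancel_left]
    exact (boxNorm_smul_le ht.1 hr.le hy).trans (mul_le_of_le_one_left hr.le ht.2)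
  let Φ : (Fin n → ℂ) →L[ℂ] (Fin n → ℂ) := A.mulVecLin.toContinuousLinearMap
  have hderiv : ∀ t ∈ Set.Icc (0 : ℝ) 1,
      HasFDerivAt (fun z => z - A.mulVec (F z) - x)
        ((ContinuousLinearMap.id ℂ _ - Φ.comp (fderiv ℂ F (x + t • d))).restrictScalars ℝ)
        (x + t • d) := fun t ht => by
    have hFt := (hF.differentiableAt (hU.mem_nhds (hbox (hseg t ht)))).hasFDerivAt
    exact (((hasFDerivAt_id _).sub (Φ.hasFDerivAt.comp _ hFt)).sub_const x).restrictScalars ℝ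
  have hL : ∀ L : (Fin n → ℂ) →L[ℝ] ℝ,
      (∀ v, boxNorm v ≤ r * ρ → |L v| ≤ r * ρ) →
        |L (x + d - A.mulVec (F (x + d)) - x)| ≤ r * ρ := by
    intro L hLv
    obtain ⟨t, ht, h⟩ := exists_clm_sub_eq_fderiv_segment
      (f' := fun z => (ContinuousLinearMap.id ℂ _ - Φ.comp (fderiv ℂ F z)).restrictScalars ℝ)
      hderiv L
    have hscale : r • (r⁻¹ • d - A.mulVec (fderiv ℂ F (x + t • d) (r⁻¹ • d)))
        = d - A.mulVec (fderiv ℂ F (x + t • d) d) := by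
      rw [(fderiv ℂ F (x + t • d)).map_smul_of_tower, Matrix.mulVec_smul, ← smul_sub,
        smul_inv_smul₀ hr.ne']
    have hbound := hLv _ (hK _ (hseg t ht) _ hb)
    rw [hscale, map_add] at hbound
    rw [sub_eq_iff_eq_add'.1 h]
    simpa [Φ, sub_right_comm x] using hbound
  have hrρ : 0 ≤ r * ρ := (mul_pos hr hρ0).le
  rw [boxNorm_le_iff hrρ]
  intro i
  exact ⟨hL (Complex.reCLM.comp (ContinuousLinearMap.proj i))
      fun v hv => ((boxNorm_le_iff hrρ).1 hv i).1,
    hL (Complex.imCLM.comp (ContinuousLinearMap.proj i))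
      fun v hv => ((boxNorm_le_iff hrρ).1 hv i).2⟩
end

section
/- If T is a spanning tree of Γ and h : T.Adj u v is an edge of T (hence also an edge of Γ), then the permutation σ_{T,h} := φ_{T,v}⁻¹ ∘ γ_h ∘ φ_{T,u} of S z₀ is the identity. -/
namespace HomotopyGraph

variable {V : Type*} {S : V → Type*}

/-- The composite of the edge correspondences along a walk. -/
def Phi {Γ : SimpleGraph V} (γ : ∀ {u v : V}, Γ.Adj u v → (S u ≃ S v)) :
    ∀ {u v : V}, Γ.Walk u v → (S u ≃ S v)
  | _, _, SimpleGraph.Walk.nil => Equiv.refl _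
  | _, _, SimpleGraph.Walk.cons h p => (γ h).trans (Phi γ p)

theorem Phi_concat {Γ : SimpleGraph V} (γ : ∀ {u v : V}, Γ.Adj u v → (S u ≃ S v))
    {u v w : V} (p : Γ.Walk u v) (h : Γ.Adj v w) :
    Phi γ (p.concat h) = (Phi γ p).trans (γ h) := by
  induction p with
  | nil => rfl
  | cons h' p ih => rw [SimpleGraph.Walk.concat_cons, Phi, ih, Phi, Equiv.trans_assoc]

/-- If `T` is a spanning tree of `Γ` and `h : T.Adj u v` is an edge of `T`, then the
permutation `σ_{T,h} = φ_{T,v}⁻¹ ∘ γ_h ∘ φ_{T,u}` of `S z₀` is the identity, where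
`φ_{T,u}` is the composite correspondence along the unique path in `T` from `z₀`
to `u`. -/
theorem tree_edge_permutation_eq_refl
    {Γ : SimpleGraph V} (hconn : Γ.Connected) (z₀ : V)
    (γ : ∀ {u v : V}, Γ.Adj u v → (S u ≃ S v))
    (hsymm : ∀ {u v : V} (h : Γ.Adj u v), γ h.symm = (γ h).symm)
    (T : SimpleGraph V) (hle : T ≤ Γ) (hT : T.IsTree)
    {u v : V} (h : T.Adj u v)
    (p : T.Walk z₀ u) (hp : p.IsPath) (q : T.Walk z₀ v) (hq : q.IsPath) :
    (Phi (fun {a b} h' => γ (hle h')) p).trans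
      ((γ (hle h)).trans (Phi (fun {a b} h' => γ (hle h')) q).symm) =
    Equiv.refl (S z₀) := by
  by_cases hv : v ∈ p.support
  · rw [hT.isAcyclic.path_concat hq hp h.symm hv, Phi_concat, hsymm (hle h)]
    ext x
    simp
  · have hu := hT.isAcyclic.mem_support_of_ne_mem_support_of_adj_of_isPath hq hp h.symm hv
    rw [hT.isAcyclic.path_concat hp hq h hu, Phi_concat]
    ext x
    simp

end HomotopyGraph
end

section
/- Let T be a spanning tree of Γ. The subgroup of the permutation group of S z₀ generated by the permutations σ_{T,h} := φ_{T,v}⁻¹ ∘ γ_h ∘ φ_{T,u}, as h ranges over the edges of Γ that do not belong to T, equals the monodromy group Mon_{Γ,z₀}, i.e., the subgroup generated by Φ(w) over all closed walks w at z₀. -/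
namespace HomotopyGraph

variable {V : Type*} {S : V → Type*}

/-- The monodromy group encoded by a homotopy graph: the subgroup of the permutation
group of the base fiber generated by `Φ(w)` over all closed walks `w` at `z₀`. -/
def monodromyGroup (Γ : SimpleGraph V) (z₀ : V)
    (γ : ∀ {u v : V}, Γ.Adj u v → (S u ≃ S v)) :
    Subgroup (Equiv.Perm (S z₀)) :=
  Subgroup.closure {g : Equiv.Perm (S z₀) | ∃ w : Γ.Walk z₀ z₀, g = Phi γ w}

@[simp]
theorem Phi_append {Γ : SimpleGraph V} (γ : ∀ {u v : V}, Γ.Adj u v → (S u ≃ S v))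
    {u v w : V} (p : Γ.Walk u v) (q : Γ.Walk v w) :
    Phi γ (p.append q) = (Phi γ p).trans (Phi γ q) := by
  induction p with
  | nil => rfl
  | cons h p ih => simp [Phi, ih, Equiv.trans_assoc]

theorem Phi_reverse {Γ : SimpleGraph V} (γ : ∀ {u v : V}, Γ.Adj u v → (S u ≃ S v))
    (hsymm : ∀ {u v : V} (h : Γ.Adj u v), γ h.symm = (γ h).symm)
    {u v : V} (p : Γ.Walk u v) : Phi γ p.reverse = (Phi γ p).symm := by
  induction p with
  | nil => rfl
  | cons h p ih =>
    rw [SimpleGraph.Walk.reverse_cons, Phi_append, ih]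
    ext x
    simpa [Phi] using congrArg (fun e => e ((Phi γ p).symm x)) (hsymm h)

theorem Phi_mapLe {Γ T : SimpleGraph V} (γ : ∀ {u v : V}, Γ.Adj u v → (S u ≃ S v))
    (hle : T ≤ Γ) {u v : V} (p : T.Walk u v) :
    Phi γ (p.mapLe hle) = Phi (fun {_ _} h => γ (hle h)) p := by
  induction p with
  | nil => rfl
  | cons h p ih => exact congrArg (fun e => (γ (hle h)).trans e) ih

/-- In an acyclic graph, extending the path to `u` by an edge from `u` to `v` has the same
composite as the path to `v`. -/
theorem Phi_trans_of_isAcyclic {T : SimpleGraph V} (hT : T.IsAcyclic)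
    (γ : ∀ {u v : V}, T.Adj u v → (S u ≃ S v))
    (hsymm : ∀ {u v : V} (h : T.Adj u v), γ h.symm = (γ h).symm)
    {z u v : V} (h : T.Adj u v) {p : T.Walk z u} {q : T.Walk z v}
    (hp : p.IsPath) (hq : q.IsPath) : (Phi γ p).trans (γ h) = Phi γ q := by
  classical
  by_cases hv : v ∈ p.support
  · have htake : p.takeUntil v hv = q :=
      congrArg Subtype.val ((hT.subsingleton_path _ _).elim ⟨_, hp.takeUntil hv⟩ ⟨q, hq⟩)
    have hdrop : p.dropUntil v hv = h.symm.toWalk :=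
      congrArg Subtype.val ((hT.subsingleton_path _ _).elim ⟨_, hp.dropUntil hv⟩ (SimpleGraph.Path.singleton h.symm))
    rw [← p.take_spec hv, Phi_append, htake, hdrop]
    ext x
    have hinv := congrArg (fun e => γ h (e (Phi γ q x))) (hsymm h)
    simpa [Phi] using hinv
  · have hconcat : p.concat h = q :=
      congrArg Subtype.val ((hT.subsingleton_path _ _).elim ⟨_, hp.concat hv h⟩ ⟨q, hq⟩)
    rw [← hconcat, SimpleGraph.Walk.concat_eq_append, Phi_append]
    rfl

/-- A subgroup containing the off-tree generators contains the closing-up, along tree paths,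
of every walk. -/
theorem trans_Phi_trans_symm_mem {Γ T : SimpleGraph V} {z₀ : V}
    (γ : ∀ {u v : V}, Γ.Adj u v → (S u ≃ S v))
    (hsymm : ∀ {u v : V} (h : Γ.Adj u v), γ h.symm = (γ h).symm)
    (hle : T ≤ Γ) (hT : T.IsTree) (H : Subgroup (Equiv.Perm (S z₀)))
    (hH : ∀ {u v : V} (h : Γ.Adj u v), ¬ T.Adj u v →
      ∀ (p : T.Walk z₀ u) (q : T.Walk z₀ v), p.IsPath → q.IsPath →
        (Phi (fun {_ _} h' => γ (hle h')) p).trans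
          ((γ h).trans (Phi (fun {_ _} h' => γ (hle h')) q).symm) ∈ H)
    {u v : V} (w : Γ.Walk u v) {p : T.Walk z₀ u} {q : T.Walk z₀ v}
    (hp : p.IsPath) (hq : q.IsPath) :
    (Phi (fun {_ _} h' => γ (hle h')) p).trans
      ((Phi γ w).trans (Phi (fun {_ _} h' => γ (hle h')) q).symm) ∈ H := by
  induction w with
  | nil =>
    obtain rfl : p = q := (hT.existsUnique_path _ _).unique hp hq
    convert H.one_mem
    ext x
    simp [Phi]
  | @cons u m v h w ih =>
    obtain ⟨r, hr, -⟩ := hT.existsUnique_path z₀ m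
    have hstep : (Phi (fun {_ _} h' => γ (hle h')) p).trans
        ((γ h).trans (Phi (fun {_ _} h' => γ (hle h')) r).symm) ∈ H := by
      by_cases hadj : T.Adj u m
      · rw [← Equiv.trans_assoc,
          Phi_trans_of_isAcyclic hT.isAcyclic (fun {_ _} h' => γ (hle h'))
            (fun h' => hsymm (hle h')) hadj hp hr, Equiv.self_trans_symm]
        exact H.one_mem
      · exact hH h hadj p r hp hr
    convert H.mul_mem (ih hr hq) hstep using 1
    ext x
    simp [Phi]

/-- The subgroup generated by the permutations `σ_{T,h} = φ_{T,v}⁻¹ ∘ γ_h ∘ φ_{T,u}`,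
as `h = (u,v)` ranges over the edges of `Γ` not belonging to the spanning tree `T`,
equals the full monodromy group `Mon_{Γ,z₀}`. -/
theorem offTree_generators
    {Γ : SimpleGraph V} (hconn : Γ.Connected) (z₀ : V)
    (γ : ∀ {u v : V}, Γ.Adj u v → (S u ≃ S v))
    (hsymm : ∀ {u v : V} (h : Γ.Adj u v), γ h.symm = (γ h).symm)
    (T : SimpleGraph V) (hle : T ≤ Γ) (hT : T.IsTree) :
    Subgroup.closure
      {g : Equiv.Perm (S z₀) | ∃ (u v : V) (h : Γ.Adj u v), ¬ T.Adj u v ∧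
        ∃ (p : T.Walk z₀ u) (q : T.Walk z₀ v), p.IsPath ∧ q.IsPath ∧
          g = (Phi (fun {a b} h' => γ (hle h')) p).trans
                ((γ h).trans (Phi (fun {a b} h' => γ (hle h')) q).symm)} =
    monodromyGroup Γ z₀ γ := by
  apply le_antisymm
  · refine Subgroup.closure_mono ?_
    rintro _ ⟨u, v, h, -, p, q, -, -, rfl⟩
    refine ⟨(p.mapLe hle).append (.cons h (q.mapLe hle).reverse), ?_⟩
    rw [Phi_append, Phi, Phi_reverse γ hsymm, Phi_mapLe, Phi_mapLe]
  · refine (Subgroup.closure_le _).2 ?_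
    rintro _ ⟨w, rfl⟩
    refine trans_Phi_trans_symm_mem γ hsymm hle hT _ ?_ w (p := .nil) (q := .nil) .nil .nil
    intro u v h hadj p q hp hq
    exact Subgroup.subset_closure ⟨u, v, h, hadj, p, q, hp, hq, rfl⟩

end HomotopyGraph
end

section
/- For d ≥ 1, the Galois group of the generic monic degree-d polynomial over ℂ is the full symmetric group: letting K be the field of rational functions ℂ(c₀, …, c_{d−1}) (the fraction field of the polynomial ring over ℂ in d indeterminates c₀, …, c_{d−1}) and p := X^d + c_{d−1}X^{d−1} + ⋯ + c₁X + c₀ ∈ K[X], the Galois group of the splitting field of p over K is isomorphic to the symmetric group S_d on d letters. -/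
open Polynomial

/-- If `p` has distinct roots `x i` in an extension `E` of `F` and every permutation of the roots
is induced by an automorphism of `E` over `F`, then the Galois group of `p` is the full
symmetric group on the index set. -/
theorem Polynomial.Gal.nonempty_mulEquiv_perm {F E ι : Type*} [Field F] [Field E] [Algebra F E]
    [Fintype ι] (p : F[X]) (x : ι → E) (hx : Function.Injective x)
    (hp : p.map (algebraMap F E) = ∏ i, (X - C (x i)))
    (θ : Equiv.Perm ι →* (E ≃ₐ[F] E)) (hθ : ∀ σ i, θ σ (x i) = x (σ i)) :
    Nonempty (p.Gal ≃* Equiv.Perm ι) := by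
  classical
  have : Fact (p.map (algebraMap F E)).Splits :=
    ⟨by rw [hp]; exact Splits.prod fun i _ => Splits.X_sub_C (x i)⟩
  have hp0 : p ≠ 0 := by
    rintro rfl
    have h := (monic_prod_X_sub_C x Finset.univ).ne_zero
    rw [← hp] at h
    simp at h
  have hroot (y : E) : y ∈ p.rootSet E ↔ ∃ i, x i = y := by
    rw [mem_rootSet_of_ne hp0, ← eval_map_algebraMap, hp, eval_prod, Finset.prod_eq_zero_iff]
    simp [sub_eq_zero, eq_comm]
  let e : ι ≃ p.rootSet E := Equiv.ofBijective (fun i => ⟨x i, (hroot _).2 ⟨i, rfl⟩⟩)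
    ⟨fun i j h => hx (congrArg Subtype.val h), fun ⟨y, hy⟩ => by
      obtain ⟨i, rfl⟩ := (hroot y).1 hy
      exact ⟨i, rfl⟩⟩
  have hval (σ : Equiv.Perm ι) :
      galActionHom p E (restrict p E (θ σ)) = e.permCongr σ := by
    refine Equiv.ext fun y => Subtype.ext ?_
    obtain ⟨i, rfl⟩ := e.surjective y
    rw [galActionHom_restrict, Equiv.permCongr_apply, Equiv.symm_apply_apply]
    exact hθ σ i
  refine ⟨(MulEquiv.ofBijective ((restrict p E).comp θ) ⟨fun σ τ h => ?_, fun g => ?_⟩).symm⟩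
  · apply e.permCongr.injective
    rw [← hval, ← hval]
    exact congrArg (galActionHom p E) h
  · refine ⟨e.permCongr.symm (galActionHom p E g), galActionHom_injective p E ?_⟩
    rw [MonoidHom.comp_apply, hval, Equiv.apply_symm_apply]

/-- If an algebra structure on a polynomial ring has symmetric scalars, then permutations of the
variables act by algebra automorphisms. -/
noncomputable def MvPolynomial.permAlgEquivHom {A ι R : Type*} [CommSemiring A] [CommSemiring R]
    [Algebra A (MvPolynomial ι R)]
    (h : ∀ a, (algebraMap A (MvPolynomial ι R) a).IsSymmetric) :
    Equiv.Perm ι →* (MvPolynomial ι R ≃ₐ[A] MvPolynomial ι R) where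
  toFun σ := AlgEquiv.ofRingEquiv (f := (renameEquiv R σ).toRingEquiv) fun a => h a σ
  map_one' := by
    ext1 q
    exact rename_id_apply q
  map_mul' σ τ := by
    ext1 q
    exact (rename_rename τ σ q).symm

/-- Let `φ` embed a ring `A` into the symmetric polynomials over `k`. If `φ` maps the coefficients
of `P` to those of `∏ i, (X + xᵢ)`, then `P` has full symmetric Galois group over the fraction
field of `A`. -/
theorem MvPolynomial.nonempty_gal_mulEquiv_perm_of_symmetric {A K k ι : Type*} (L : Type*) [CommRing A]
    [Field K] [Algebra A K] [IsFractionRing A K] [Field k] [Fintype ι]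
    [Field L] [Algebra (MvPolynomial ι k) L] [IsFractionRing (MvPolynomial ι k) L]
    (φ : A →+* MvPolynomial ι k) (hφ : Function.Injective φ) (hsymm : ∀ a, (φ a).IsSymmetric)
    (P : A[X]) (hP : P.map φ = ∏ i, (Polynomial.X + Polynomial.C (MvPolynomial.X i))) :
    Nonempty ((P.map (algebraMap A K)).Gal ≃* Equiv.Perm ι) := by
  have hB : Function.Injective (algebraMap (MvPolynomial ι k) L) := IsFractionRing.injective _ _
  let : Algebra A (MvPolynomial ι k) := φ.toAlgebra
  let : Algebra A L := ((algebraMap (MvPolynomial ι k) L).comp φ).toAlgebra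
  have : IsScalarTower A (MvPolynomial ι k) L := .of_algebraMap_eq' rfl
  have hA : Function.Injective (algebraMap A L) := hB.comp hφ
  let : Algebra K L := (IsFractionRing.lift hA).toAlgebra
  have : IsScalarTower A K L :=
    .of_algebraMap_eq fun a => (IsFractionRing.lift_algebraMap hA a).symm
  refine Polynomial.Gal.nonempty_mulEquiv_perm (E := L) _
    (fun i => -algebraMap (MvPolynomial ι k) L (MvPolynomial.X i)) ?_ ?_
    ((IsFractionRing.fieldEquivOfAlgEquivHom K L).comp (permAlgEquivHom (A := A) hsymm)) ?_
  · exact neg_injective.comp (hB.comp (MvPolynomial.X_injective))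
  · rw [Polynomial.map_map, ← IsScalarTower.algebraMap_eq,
      IsScalarTower.algebraMap_eq A (MvPolynomial ι k) L, ← Polynomial.map_map]
    change (P.map φ).map _ = _
    rw [hP, Polynomial.map_prod]
    simp
  · intro σ i
    simp only [MonoidHom.comp_apply, IsFractionRing.fieldEquivOfAlgEquivHom_apply, map_neg,
      IsFractionRing.fieldEquivOfAlgEquiv_algebraMap]
    exact congrArg (fun q => -algebraMap (MvPolynomial ι k) L q) (rename_X σ i)

/-- The specialization sending the coefficients of the generic monic polynomial of degree `d` to
those of `∏ i, (X + xᵢ)`. -/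
noncomputable def MvPolynomial.esymmRevAlgHom (R : Type*) [CommRing R] (d : ℕ) :
    MvPolynomial (Fin d) R →ₐ[R] MvPolynomial (Fin d) R :=
  (symmetricSubalgebra (Fin d) R).val.comp ((esymmAlgHom (Fin d) R d).comp (rename Fin.rev))

theorem MvPolynomial.esymmRevAlgHom_injective (R : Type*) [CommRing R] (d : ℕ) :
    Function.Injective (esymmRevAlgHom R d) := by
  intro q r h
  have h' : esymmAlgHom (Fin d) R d (rename Fin.rev q) =
      esymmAlgHom (Fin d) R d (rename Fin.rev r) := Subtype.ext h
  exact rename_injective _ Fin.rev_injective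
    (esymmAlgHom_injective R (Fintype.card_fin d).ge h')

theorem MvPolynomial.isSymmetric_esymmRevAlgHom {R : Type*} [CommRing R] {d : ℕ}
    (q : MvPolynomial (Fin d) R) : (esymmRevAlgHom R d q).IsSymmetric :=
  (esymmAlgHom (Fin d) R d (rename Fin.rev q)).2

theorem MvPolynomial.esymmRevAlgHom_X (R : Type*) [CommRing R] {d : ℕ} (i : Fin d) :
    esymmRevAlgHom R d (MvPolynomial.X i) = esymm (Fin d) R (d - i) := by
  have h : d - (i + 1) + 1 = d - (i : ℕ) := by omega
  simp [esymmRevAlgHom, esymmAlgHom, h]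

theorem MvPolynomial.map_esymmRevAlgHom_generic (R : Type*) [CommRing R] (d : ℕ) :
    (Polynomial.X ^ d + ∑ i : Fin d, Polynomial.C (MvPolynomial.X i) * Polynomial.X ^ (i : ℕ)).map
      (esymmRevAlgHom R d : MvPolynomial (Fin d) R →+* MvPolynomial (Fin d) R) =
      ∏ i, (Polynomial.X + Polynomial.C (MvPolynomial.X i)) := by
  rw [prod_C_add_X_eq_sum_esymm, Fintype.card_fin, Finset.sum_range_succ',
    ← Finset.sum_range_reflect, Finset.sum_range, add_comm]
  simp only [Polynomial.map_add, Polynomial.map_sum, Polynomial.map_mul, Polynomial.map_pow,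
    Polynomial.map_X, Polynomial.map_C, esymm_zero, map_one, one_mul, Nat.sub_zero,
    RingHom.coe_coe, esymmRevAlgHom_X]
  congr 1
  refine Finset.sum_congr rfl fun i _ => ?_
  have h₁ : d - 1 - (i : ℕ) + 1 = d - i := by omega
  have h₂ : d - (d - (i : ℕ)) = i := by omega
  rw [h₁, h₂]

/-- The Galois group of the generic monic degree-`d` polynomial over `ℂ` is the full
symmetric group `S_d`: over `K = ℂ(c₀, …, c_{d−1})`, the splitting field of
`p = X^d + c_{d−1}X^{d−1} + ⋯ + c₁X + c₀` has Galois group isomorphic to `S_d`. -/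
theorem generic_polynomial_gal_eq_symm (d : ℕ) (hd : 1 ≤ d) :
    let K := FractionRing (MvPolynomial (Fin d) ℂ)
    let c : Fin d → K := fun i => algebraMap (MvPolynomial (Fin d) ℂ) K (MvPolynomial.X i)
    let p : K[X] := X ^ d + ∑ i : Fin d, C (c i) * X ^ (i : ℕ)
    Nonempty (p.Gal ≃* Equiv.Perm (Fin d)) := by
  intro K c p
  have h := MvPolynomial.nonempty_gal_mulEquiv_perm_of_symmetric (K := K)
    (FractionRing (MvPolynomial (Fin d) ℂ))
    (MvPolynomial.esymmRevAlgHom ℂ d : MvPolynomial (Fin d) ℂ →+* MvPolynomial (Fin d) ℂ)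
    (MvPolynomial.esymmRevAlgHom_injective ℂ d) MvPolynomial.isSymmetric_esymmRevAlgHom _
    (MvPolynomial.map_esymmRevAlgHom_generic ℂ d)
  have hp : p = (X ^ d + ∑ i : Fin d, C (MvPolynomial.X i) * X ^ (i : ℕ)).map
      (algebraMap (MvPolynomial (Fin d) ℂ) K) := by
    simp only [p, c, Polynomial.map_add, Polynomial.map_sum, Polynomial.map_mul,
      Polynomial.map_pow, Polynomial.map_X, Polynomial.map_C]
  rw [hp]
  exact h
end

section
/- For d ≥ 1, the Galois group of the generic monic polynomial in even-degree terms has order 2^d · d!: letting K be the field of rational functions ℂ(c₀, …, c_{d−1}) and q := X^{2d} + c_{d−1}X^{2(d−1)} + ⋯ + c₁X² + c₀ ∈ K[X], the Galois group of the splitting field of q over K is a finite group of cardinality 2^d · d! (it is the wreath product S₂ ≀ S_d). -/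
open Polynomial

/-- If `q` splits as `∏ (X² - xᵢ²)` over `L = K(x)`, with the elements `±xᵢ` pairwise distinct, and
every signed permutation of the `xᵢ` extends to a `K`-endomorphism of `L`, then the Galois group of
`q` has order `2 ^ n * n!`. -/
theorem Polynomial.card_gal_of_signed_perm_extend {K L ι : Type*} [Field K] [Field L] [Algebra K L]
    [Fintype ι] (x : ι → L)
    (hx : Function.Injective fun p : ι × ℤˣ => ((p.2 : ℤ) : L) * x p.1)
    (q : K[X]) (hq : q.map (algebraMap K L) = ∏ i, (X ^ 2 - C (x i ^ 2)))
    (hgen : IntermediateField.adjoin K (Set.range x) = ⊤)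
    (hext : ∀ (π : Equiv.Perm ι) (ε : ι → ℤˣ), ∃ f : L →ₐ[K] L,
      ∀ i, f (x i) = ((ε i : ℤ) : L) * x (π i)) :
    Nat.card q.Gal = 2 ^ Fintype.card ι * (Fintype.card ι).factorial := by
  classical
  have hroot (y : L) : aeval y q = 0 ↔ ∃ i, y = x i ∨ y = -x i := by
    rw [aeval_def, ← eval_map, hq, eval_prod, Finset.prod_eq_zero_iff]
    simp [sub_eq_zero, sq_eq_sq_iff_eq_or_eq_neg]
  have hq0 : q.map (algebraMap K L) ≠ 0 := by
    rw [hq]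
    exact (monic_prod_of_monic _ _ fun i _ => monic_X_pow_sub_C _ two_ne_zero).ne_zero
  have hsplit : q.IsSplittingField K L := by
    refine isSplittingField_iff_intermediateField.mpr ⟨?_, ?_⟩
    · rw [hq]
      refine Splits.prod fun i _ => ?_
      rw [C_pow, sq_sub_sq]
      exact (Splits.X_add_C _).mul (Splits.X_sub_C _)
    · rw [eq_top_iff, ← hgen]
      refine IntermediateField.adjoin.mono _ _ _ ?_
      rintro _ ⟨i, rfl⟩
      exact mem_rootSet'.mpr ⟨hq0, (hroot _).mpr ⟨i, .inl rfl⟩⟩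
  have : FiniteDimensional K L := IsSplittingField.finiteDimensional L q
  have halg (f : L →ₐ[K] L) : Function.Bijective f := Algebra.IsAlgebraic.algHom_bijective f
  choose f hf using hext
  let g (p : Equiv.Perm ι × (ι → ℤˣ)) : L ≃ₐ[K] L := .ofBijective (f p.1 p.2) (halg _)
  have hg (p : Equiv.Perm ι × (ι → ℤˣ)) (i : ι) : g p (x i) = ((p.2 i : ℤ) : L) * x (p.1 i) :=
    hf p.1 p.2 i
  have hginj : Function.Injective g := by
    intro p p' h
    have key (i : ι) : (p.1 i, p.2 i) = (p'.1 i, p'.2 i) := by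
      apply hx
      simp only
      rw [← hg, ← hg, h]
    simp only [Prod.mk.injEq] at key
    exact Prod.ext (Equiv.ext fun i => (key i).1) (_root_.funext fun i => (key i).2)
  have hgsurj : Function.Surjective g := by
    intro σ
    have hσ (i : ι) : ∃ p : ι × ℤˣ, σ (x i) = ((p.2 : ℤ) : L) * x p.1 := by
      have h : aeval (σ (x i)) q = 0 := by
        rw [← AlgEquiv.coe_toAlgHom, aeval_algHom_apply, (hroot _).mpr ⟨i, .inl rfl⟩, map_zero]
      obtain ⟨k, hk | hk⟩ := (hroot _).mp h
      · exact ⟨(k, 1), by simpa using hk⟩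
      · exact ⟨(k, -1), by simpa using hk⟩
    choose p hp using hσ
    have hpinj : Function.Injective fun i => (p i).1 := by
      intro i j hij
      have h : ((p j).2 : ℤ) * x i = (((p i).2 : ℤ) : L) * x j := by
        apply σ.injective
        simp only at hij
        rw [map_mul, map_mul, map_intCast, map_intCast, hp i, hp j, hij]
        ring
      exact congrArg Prod.fst (hx (a₁ := (i, (p j).2)) (a₂ := (j, (p i).2)) h)
    refine ⟨(Equiv.ofBijective _ (Finite.injective_iff_bijective.mp hpinj), fun i => (p i).2), ?_⟩
    have htop : Algebra.adjoin K (Set.range x) = ⊤ := by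
      rw [← IntermediateField.adjoin_toSubalgebra_of_isAlgebraic, hgen,
        IntermediateField.top_toSubalgebra]
      exact fun y _ => Algebra.IsAlgebraic.isAlgebraic y
    refine AlgEquiv.coe_toAlgHom_injective (AlgHom.ext_of_adjoin_eq_top htop ?_)
    rintro _ ⟨i, rfl⟩
    exact (hg _ i).trans (hp i).symm
  rw [show Nat.card q.Gal = Nat.card (L ≃ₐ[K] L) from Nat.card_congr
      (AlgEquiv.autCongr (IsSplittingField.algEquiv L q)).symm.toEquiv,
    ← Nat.card_eq_of_bijective g ⟨hginj, hgsurj⟩, Nat.card_eq_fintype_card, Fintype.card_prod,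
    Fintype.card_perm, Fintype.card_fun, Fintype.card_units_int, mul_comm]

namespace MvPolynomial

variable {σ R : Type*} [CommRing R]

/-- Substituting `εᵢ X_{π i}` for `Xᵢ`, where `π` is a permutation and `ε` a family of signs, is
injective. -/
theorem aeval_sign_mul_X_perm_injective (π : Equiv.Perm σ) (ε : σ → ℤˣ) :
    Function.Injective
      (aeval (R := R) fun i => ((ε i : ℤ) : MvPolynomial σ R) * X (π i)) := by
  refine Function.LeftInverse.injective
    (g := aeval fun i => ((ε (π.symm i) : ℤ) : MvPolynomial σ R) * X (π.symm i)) fun p => ?_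
  rw [← AlgHom.comp_apply]
  conv_rhs => rw [← AlgHom.id_apply (R := R) p]
  congr 1
  ext i : 1
  simp [← mul_assoc, ← Int.cast_mul, ← Units.val_mul]

/-- The polynomial `∏ (T - Xᵢ²)` whose roots are the squares of the variables. -/
noncomputable def prodSubSq (σ R : Type*) [CommRing R] [Fintype σ] : (MvPolynomial σ R)[X] :=
  ∏ i, (Polynomial.X - Polynomial.C (X i ^ 2))

theorem prodSubSq_monic [Fintype σ] : (prodSubSq σ R).Monic :=
  Polynomial.monic_prod_X_sub_C _ _

theorem natDegree_prodSubSq [Fintype σ] [Nontrivial R] :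
    (prodSubSq σ R).natDegree = Fintype.card σ :=
  Polynomial.natDegree_finsetProd_X_sub_C_eq_card _ _

/-- Signed permutations of the variables fix the coefficients of `∏ (T - Xᵢ²)`. -/
theorem map_prodSubSq [Fintype σ] (π : Equiv.Perm σ) (ε : σ → ℤˣ) :
    (prodSubSq σ R).map
      (aeval (R := R) fun i => ((ε i : ℤ) : MvPolynomial σ R) * X (π i)).toRingHom =
      prodSubSq σ R := by
  have hε (i : σ) : ((ε i : ℤ) : MvPolynomial σ R) ^ 2 = 1 := by
    rw [← Int.cast_pow, ← Units.val_pow_eq_pow_val, Int.units_sq]; simp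
  simp only [prodSubSq, Polynomial.map_prod]
  conv_rhs => rw [← Equiv.prod_comp π]
  refine Finset.prod_congr rfl fun i _ => ?_
  rw [Polynomial.map_sub, Polynomial.map_X, Polynomial.map_C]
  simp only [AlgHom.toRingHom_eq_coe, RingHom.coe_coe, map_pow, aeval_X, mul_pow, hε, one_mul]

/-- The non-leading coefficients of `∏ (T - Xᵢ²)` are algebraically independent. -/
theorem aeval_coeff_prodSubSq_injective (d : ℕ) :
    Function.Injective (aeval (R := R) fun i : Fin d => (prodSubSq (Fin d) R).coeff i) := by
  have hcoeff (i : Fin d) : (prodSubSq (Fin d) R).coeff i =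
      (-1) ^ (d - (i : ℕ)) * expand 2 (esymm (Fin d) R (d - i)) := by
    have h : prodSubSq (Fin d) R = ((Finset.univ.val.map fun i : Fin d =>
        (X i : MvPolynomial (Fin d) R)).map fun t => Polynomial.X - Polynomial.C t).prod.map
          (expand 2).toRingHom := by
      rw [Multiset.map_map]
      change _ = (∏ i, _ : (MvPolynomial (Fin d) R)[X]).map _
      simp [prodSubSq, Polynomial.map_prod]
    rw [h, Polynomial.coeff_map, Multiset.prod_X_sub_C_coeff _ (by simp),
      esymm_eq_multiset_esymm]
    simp
  have h : (aeval (R := R) fun i : Fin d => (prodSubSq (Fin d) R).coeff i) =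
      ((expand 2).comp ((symmetricSubalgebra (Fin d) R).val.comp (esymmAlgHom (Fin d) R d))).comp
        (aeval fun i : Fin d => ((((-1 : ℤˣ) ^ (d - (i : ℕ)) : ℤˣ) : ℤ) : MvPolynomial (Fin d) R) *
          X (Fin.revPerm i)) := by
    ext i : 1
    have hi : d - (i + 1 : ℕ) + 1 = d - i := by omega
    simp [hcoeff, esymmAlgHom, hi]
  rw [h]
  exact ((expand_injective two_pos).comp (Subtype.val_injective.comp
    (esymmAlgHom_fin_injective R le_rfl))).comp (aeval_sign_mul_X_perm_injective _ _)

end MvPolynomial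

open MvPolynomial in
/-- Over a field of characteristic zero, the generic monic polynomial of degree `2 * d` in even-degree
terms has Galois group of order `2 ^ d * d!`. The field `L` is its splitting field, the field of
rational functions in `d` of its roots, one from each pair `±r`. -/
theorem Polynomial.card_gal_of_isFractionRing {F K L : Type*} [Field F] [CharZero F] [Field K]
    [Field L] (d : ℕ)
    [Algebra (MvPolynomial (Fin d) F) K] [IsFractionRing (MvPolynomial (Fin d) F) K]
    [Algebra (MvPolynomial (Fin d) F) L] [IsFractionRing (MvPolynomial (Fin d) F) L] :
    Nat.card (X ^ (2 * d) + ∑ i : Fin d,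
      C (algebraMap (MvPolynomial (Fin d) F) K (MvPolynomial.X i)) * X ^ (2 * (i : ℕ)) : K[X]).Gal = 2 ^ d * d.factorial := by
  set A := MvPolynomial (Fin d) F
  have hL : Function.Injective (algebraMap A L) := IsFractionRing.injective A L
  let φ₀ : A →ₐ[F] A := MvPolynomial.aeval fun i : Fin d => (prodSubSq (Fin d) F).coeff i
  have hφ₀X (i : Fin d) : φ₀ (MvPolynomial.X i) = (prodSubSq (Fin d) F).coeff i := MvPolynomial.aeval_X _ i
  have hφ₀ : Function.Injective φ₀ := aeval_coeff_prodSubSq_injective d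
  let φ : K →+* L := IsFractionRing.lift (A := A) (g := (algebraMap A L).comp φ₀.toRingHom)
    (hL.comp hφ₀)
  have hφ (a : A) : φ (algebraMap A K a) = algebraMap A L (φ₀ a) :=
    IsFractionRing.lift_algebraMap _ _
  let _ : Algebra K L := φ.toAlgebra
  have hKL : algebraMap K L = φ := rfl
  have h := Polynomial.card_gal_of_signed_perm_extend (K := K) (L := L) (ι := Fin d)
    (fun i => algebraMap A L (MvPolynomial.X i)) ?_
    (X ^ (2 * d) + ∑ i : Fin d, C (algebraMap A K (MvPolynomial.X i)) * X ^ (2 * (i : ℕ))) ?_ ?_ ?_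
  · simpa using h
  · rintro ⟨i, s⟩ ⟨j, t⟩ h
    have hA : ((s : ℤ) : A) * MvPolynomial.X i = ((t : ℤ) : A) * MvPolynomial.X j :=
      hL (by simpa using h)
    have hs : ((s : ℤ) : F) ≠ 0 := Int.cast_ne_zero.mpr s.ne_zero
    have hij : i = j := by
      by_contra hij
      have := congrArg (MvPolynomial.eval (Pi.single i (1 : F))) hA
      simp [Ne.symm hij, hs] at this
    have hst := congrArg (MvPolynomial.eval (1 : Fin d → F)) hA
    simp only [map_mul, map_intCast, MvPolynomial.eval_X, Pi.one_apply, mul_one, Int.cast_inj,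
      Units.val_inj] at hst
    rw [hij, hst]
  · have h : (X ^ d + ∑ i : Fin d, C ((prodSubSq (Fin d) F).coeff i) * X ^ (i : ℕ) : A[X]) =
        prodSubSq (Fin d) F := by
      conv_rhs => rw [prodSubSq_monic.as_sum, natDegree_prodSubSq, Fintype.card_fin]
      rw [Finset.sum_range]
    have h2 := congrArg (fun p => (expand A 2 p).map (algebraMap A L)) h
    conv_rhs at h2 => rw [prodSubSq]
    simpa [hKL, hφ, hφ₀X, Polynomial.map_sum, Polynomial.map_prod, ← pow_mul] using h2
  · rw [eq_top_iff]
    rintro y -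
    obtain ⟨a, b, -, rfl⟩ := IsFractionRing.div_surjective (A := A) y
    suffices H : ∀ a : A, algebraMap A L a ∈ IntermediateField.adjoin K
        (Set.range fun i => algebraMap A L (MvPolynomial.X i)) from div_mem (H a) (H b)
    intro a
    induction a using MvPolynomial.induction_on with
    | C z =>
      have hz : φ₀ (MvPolynomial.C z) = MvPolynomial.C z := φ₀.commutes z
      rw [← hz, ← hφ]
      exact IntermediateField.algebraMap_mem _ _
    | add p q hp hq => rw [map_add]; exact add_mem hp hq
    | mul_X p i hp =>
      rw [map_mul]
      exact mul_mem hp (IntermediateField.subset_adjoin _ _ ⟨i, rfl⟩)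
  · intro π ε
    let ψ₀ : A →ₐ[F] A := MvPolynomial.aeval fun i => ((ε i : ℤ) : A) * MvPolynomial.X (π i)
    have hψ₀X (i : Fin d) : ψ₀ (MvPolynomial.X i) = ((ε i : ℤ) : A) * MvPolynomial.X (π i) :=
      MvPolynomial.aeval_X _ i
    have hψ₀ : Function.Injective ψ₀ := aeval_sign_mul_X_perm_injective π ε
    let ψ : L →+* L := IsFractionRing.lift (A := A) (g := (algebraMap A L).comp ψ₀.toRingHom)
      (hL.comp hψ₀)
    have hψ (a : A) : ψ (algebraMap A L a) = algebraMap A L (ψ₀ a) :=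
      IsFractionRing.lift_algebraMap _ _
    have hcomp : ψ₀.comp φ₀ = φ₀ := by
      refine MvPolynomial.algHom_ext fun i => ?_
      rw [AlgHom.comp_apply, hφ₀X]
      conv_rhs => rw [← map_prodSubSq π ε, Polynomial.coeff_map]
      rfl
    have hfix : ψ.comp φ = φ := by
      refine IsLocalization.ringHom_ext (nonZeroDivisors A) (RingHom.ext fun a => ?_)
      simp only [RingHom.comp_apply, hφ, hψ]
      rw [← AlgHom.comp_apply, hcomp]
    refine ⟨{ ψ with commutes' := fun r => RingHom.congr_fun hfix r }, fun i => ?_⟩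
    change ψ _ = _
    simp [hψ, hψ₀X]

/-- The Galois group of the generic monic polynomial in even-degree terms,
`q = X^{2d} + c_{d−1}X^{2(d−1)} + ⋯ + c₁X² + c₀` over `K = ℂ(c₀, …, c_{d−1})`,
has order `2^d · d!` (it is the wreath product `S₂ ≀ S_d`). -/
theorem generic_even_polynomial_gal_card (d : ℕ) (hd : 1 ≤ d) :
    let K := FractionRing (MvPolynomial (Fin d) ℂ)
    let c : Fin d → K := fun i => algebraMap (MvPolynomial (Fin d) ℂ) K (MvPolynomial.X i)
    let q : K[X] := X ^ (2 * d) + ∑ i : Fin d, C (c i) * X ^ (2 * (i : ℕ))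
    Nat.card q.Gal = 2 ^ d * Nat.factorial d :=
  Polynomial.card_gal_of_isFractionRing (L := FractionRing (MvPolynomial (Fin d) ℂ)) d
end

section
/- For d ≥ 1, the Galois group of the generic monic palindromic polynomial of degree 2d has order 2^d · d!: letting K be the field of rational functions ℂ(c₁, …, c_d) and p := X^{2d} + c₁X^{2d−1} + ⋯ + c_{d−1}X^{d+1} + c_dX^d + c_{d−1}X^{d−1} + ⋯ + c₁X + 1 ∈ K[X] (so the coefficient of X^i equals the coefficient of X^{2d−i}), the Galois group of the splitting field of p over K is a finite group of cardinality 2^d · d! (it is the wreath product S₂ ≀ S_d). -/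
open Polynomial

theorem IntermediateField.algHom_ext_of_adjoin_eq_top {F E K : Type*} [Field F] [Field E] [Field K]
    [Algebra F E] [Algebra F K] {S : Set E} (hS : IntermediateField.adjoin F S = ⊤)
    {f g : E →ₐ[F] K} (h : S.EqOn f g) : f = g := by
  have : f.comp (⊤ : IntermediateField F E).val = g.comp (⊤ : IntermediateField F E).val :=
    IntermediateField.algHom_ext_of_eq_adjoin _ hS.symm fun _ hx => h hx
  exact AlgHom.ext fun a => DFunLike.congr_fun this ⟨a, IntermediateField.mem_top⟩

/-- Algebraically independent generators of a field can be sent to any algebraically independent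
family of elements. -/
theorem AlgebraicIndependent.exists_algHom_apply_eq {ι k L M : Type*} [Field k] [Field L] [Field M]
    [Algebra k L] [Algebra k M] {x : ι → L} (hx : AlgebraicIndependent k x)
    (hx_top : IntermediateField.adjoin k (Set.range x) = ⊤) {y : ι → M}
    (hy : AlgebraicIndependent k y) : ∃ f : L →ₐ[k] M, ∀ i, f (x i) = y i := by
  let e : L →ₐ[k] IntermediateField.adjoin k (Set.range x) :=
    ((IntermediateField.equivOfEq hx_top).trans IntermediateField.topEquiv).symm.toAlgHom
  let g : FractionRing (MvPolynomial ι k) →ₐ[k] M :=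
    (IntermediateField.val _).comp hy.aevalEquivField.toAlgHom
  refine ⟨(g.comp hx.aevalEquivField.symm.toAlgHom).comp e, fun i => ?_⟩
  have h : hx.aevalEquivField.symm (e (x i)) =
      algebraMap (MvPolynomial ι k) _ (MvPolynomial.X i) := by
    rw [AlgEquiv.symm_apply_eq]
    apply Subtype.ext
    rw [AlgebraicIndependent.aevalEquivField_algebraMap_apply_coe, MvPolynomial.aeval_X]
    rfl
  have h' : g (algebraMap (MvPolynomial ι k) _ (MvPolynomial.X i)) = y i := by
    change ((hy.aevalEquivField _ : IntermediateField.adjoin k (Set.range y)) : M) = _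
    rw [AlgebraicIndependent.aevalEquivField_algebraMap_apply_coe, MvPolynomial.aeval_X]
  rw [← h', ← h]
  rfl

/-- If a field is generated by a finite algebraically independent family, then any family with the
same index set over which it is algebraic is algebraically independent. -/
theorem AlgebraicIndependent.of_isAlgebraic_adjoin {ι k L : Type*} [Finite ι] [Field k] [Field L]
    [Algebra k L] {x : ι → L} (hx : AlgebraicIndependent k x)
    (hx_top : IntermediateField.adjoin k (Set.range x) = ⊤) {y : ι → L}
    (hy : ∀ i, IsAlgebraic (IntermediateField.adjoin k (Set.range y)) (x i)) :
    AlgebraicIndependent k y := by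
  set F := IntermediateField.adjoin k (Set.range y) with hF
  have halg : Algebra.IsAlgebraic F L := by
    have h_le : (⊤ : IntermediateField k L) ≤ (algebraicClosure F L).restrictScalars k := by
      rw [← hx_top, IntermediateField.adjoin_le_iff]
      rintro _ ⟨i, rfl⟩
      exact mem_algebraicClosure_iff.2 (hy i)
    exact ⟨fun a => mem_algebraicClosure_iff.1 (h_le (IntermediateField.mem_top (x := a)))⟩
  have : Algebra.IsAlgebraic (Algebra.adjoin k (Set.range y)) L :=
    ⟨fun a => IntermediateField.isAlgebraic_adjoin_iff.1 (halg.isAlgebraic a)⟩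
  refine (Algebra.IsAlgebraic.isTranscendenceBasis_of_lift_le_trdeg_of_finite k y ?_).1
  exact hx.lift_cardinalMk_le_trdeg

namespace Polynomial

/-- The monic palindromic polynomial of degree `2 * d` with coefficients `1, c 0, …, c (d - 1)`. -/
noncomputable def palindromic {R : Type*} [Semiring R] {d : ℕ} (c : Fin d → R) : R[X] :=
  X ^ (2 * d) + 1 + ∑ i : Fin d, C (c i) *
    (if (i : ℕ) + 1 = d then X ^ d else X ^ ((i : ℕ) + 1) + X ^ (2 * d - ((i : ℕ) + 1)))

theorem map_palindromic {R S : Type*} [Semiring R] [Semiring S] (f : R →+* S) {d : ℕ}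
    (c : Fin d → R) : (palindromic c).map f = palindromic fun i => f (c i) := by
  simp only [palindromic, Polynomial.map_add, Polynomial.map_pow, map_X, Polynomial.map_one,
    Polynomial.map_sum, Polynomial.map_mul, map_C, apply_ite (Polynomial.map f)]

theorem eq_palindromic {R : Type*} [Semiring R] {d : ℕ} (hd : 1 ≤ d) {P : R[X]} (hP : P.Monic)
    (hdeg : P.natDegree = 2 * d) (hrev : P.reverse = P) :
    P = palindromic fun i : Fin d => P.coeff (i + 1) := by
  have hsymm (n : ℕ) (hn : n ≤ 2 * d) : P.coeff (2 * d - n) = P.coeff n := by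
    conv_rhs => rw [← hrev, coeff_reverse, hdeg, revAt_le hn]
  have hlead : P.coeff (2 * d) = 1 := by rw [← hdeg]; exact hP
  have hterm (n : ℕ) (i : Fin d) : (C (P.coeff (i + 1)) *
      (if (i : ℕ) + 1 = d then X ^ d else X ^ ((i : ℕ) + 1) + X ^ (2 * d - ((i : ℕ) + 1)))).coeff n =
      if n = i + 1 ∨ n = 2 * d - (i + 1) then P.coeff (i + 1) else 0 := by
    have := i.2
    split_ifs with h₁ h₂ h₂ <;> simp only [coeff_C_mul, coeff_add, coeff_X_pow]
    · rw [if_pos (by omega), mul_one]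
    · rw [if_neg (by omega), mul_zero]
    · rcases h₂ with h₂ | h₂
      · rw [if_pos h₂, if_neg (by omega), add_zero, mul_one]
      · rw [if_neg (by omega), if_pos h₂, zero_add, mul_one]
    · rw [if_neg (by omega), if_neg (by omega), add_zero, mul_zero]
  ext n
  simp only [palindromic, coeff_add, finsetSum_coeff, hterm, coeff_X_pow, coeff_one]
  by_cases hn : 0 < n ∧ n < 2 * d
  · rw [if_neg (by omega), if_neg (by omega), zero_add, zero_add,
      Finset.sum_eq_single ⟨min n (2 * d - n) - 1, by omega⟩]
    · rw [if_pos (by simp only; omega)]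
      rcases le_total n (2 * d - n) with h | h
      · congr 1
        simp only
        omega
      · rw [← hsymm n hn.2.le]
        congr 1
        simp only
        omega
    · intro i _ hi
      rw [if_neg]
      contrapose! hi
      ext
      simp only
      have := i.2
      omega
    · simp
  · rw [Finset.sum_eq_zero fun i _ => if_neg (by have := i.2; omega), add_zero]
    rcases Nat.eq_zero_or_pos n with rfl | h₀
    · rw [if_neg (by omega), if_pos rfl, zero_add, ← hsymm 0 (Nat.zero_le _), Nat.sub_zero, hlead]
    · rcases eq_or_ne n (2 * d) with rfl | h₁
      · rw [if_pos rfl, if_neg (by omega), add_zero, hlead]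
      · rw [if_neg h₁, if_neg (by omega), add_zero, coeff_eq_zero_of_natDegree_lt (by omega)]

/-- The polynomial whose roots are the `x i` and their inverses. -/
noncomputable def prodInvPairs {L : Type*} [Field L] {d : ℕ} (x : Fin d → L) : L[X] :=
  ∏ i, ∏ e : ℤˣ, (X - C (x i ^ (e : ℤ)))

section

variable {L : Type*} [Field L] {d : ℕ} (x : Fin d → L)

theorem monic_prodInvPairs : (prodInvPairs x).Monic :=
  monic_prod_of_monic _ _ fun _ _ => monic_prod_of_monic _ _ fun _ _ => monic_X_sub_C _

theorem natDegree_prodInvPairs : (prodInvPairs x).natDegree = 2 * d := by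
  rw [prodInvPairs, natDegree_prod_of_monic _ _ fun _ _ =>
    monic_prod_of_monic _ _ fun _ _ => monic_X_sub_C _]
  have h (i : Fin d) : (∏ e : ℤˣ, (X - C (x i ^ (e : ℤ)))).natDegree = 2 := by
    rw [natDegree_prod_of_monic _ _ fun _ _ => monic_X_sub_C _]
    simp
  rw [Finset.sum_congr rfl fun i _ => h i]
  simp [mul_comm]

theorem reverse_X_sub_C_mul_X_sub_C_inv {a : L} (ha : a ≠ 0) :
    reverse ((X - C a) * (X - C a⁻¹)) = (X - C a) * (X - C a⁻¹) := by
  have h : (X - C a) * (X - C a⁻¹) = C 1 * X ^ 2 + C (-(a + a⁻¹)) * X + C 1 := by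
    have : C a * C a⁻¹ = 1 := by rw [← C_mul, mul_inv_cancel₀ ha, C_1]
    simp only [C_neg, C_add, C_1]
    linear_combination this
  have hdeg : ((X - C a) * (X - C a⁻¹)).natDegree = 2 := by
    rw [h, natDegree_quadratic one_ne_zero]
  ext n
  rw [coeff_reverse, hdeg]
  rcases Nat.lt_or_ge 2 n with hn | hn
  · rw [revAt_eq_self_of_lt hn]
  · rw [revAt_le hn, h]
    interval_cases n <;> simp [coeff_X, coeff_C, coeff_one]

theorem reverse_prodInvPairs (hx : ∀ i, x i ≠ 0) :
    (prodInvPairs x).reverse = prodInvPairs x := by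
  unfold prodInvPairs
  refine Finset.prod_induction _ (fun P : L[X] => P.reverse = P)
    (fun P Q hP hQ => by rw [reverse_mul_of_domain, hP, hQ]) ?_ fun i _ => ?_
  · simpa using reverse_C (1 : L)
  · simpa [Finset.prod_insert] using reverse_X_sub_C_mul_X_sub_C_inv (hx i)

theorem isRoot_prodInvPairs_iff {a : L} :
    (prodInvPairs x).IsRoot a ↔ ∃ i, ∃ e : ℤˣ, a = x i ^ (e : ℤ) := by
  simp only [prodInvPairs, IsRoot, eval_prod, Finset.prod_eq_zero_iff, Finset.mem_univ, true_and,
    eval_sub, eval_X, eval_C, sub_eq_zero]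

theorem splits_prodInvPairs : (prodInvPairs x).Splits :=
  Splits.prod fun _ _ => Splits.prod fun _ _ => Splits.X_sub_C _

theorem map_prodInvPairs_eq_self {f : L →+* L} {π : Equiv.Perm (Fin d)} {ε : Fin d → ℤˣ}
    (hf : ∀ i, f (x i) = x (π i) ^ (ε i : ℤ)) :
    (prodInvPairs x).map f = prodInvPairs x := by
  conv_rhs => rw [prodInvPairs, ← Equiv.prod_comp π]
  simp only [prodInvPairs, Polynomial.map_prod]
  refine Finset.prod_congr rfl fun i _ => ?_
  conv_rhs => rw [← Equiv.prod_comp (Equiv.mulLeft (ε i))]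
  simp [hf, zpow_mul]

theorem prodInvPairs_eq_palindromic (hd : 1 ≤ d) (hx : ∀ i, x i ≠ 0) :
    prodInvPairs x = palindromic fun i : Fin d => (prodInvPairs x).coeff (i + 1) :=
  eq_palindromic hd (monic_prodInvPairs x) (natDegree_prodInvPairs x) (reverse_prodInvPairs x hx)

theorem map_palindromic_eq_prodInvPairs {K : Type*} [Field K] [Algebra K L] {x : Fin d → L}
    {c : Fin d → K} (hd : 1 ≤ d) (hx : ∀ i, x i ≠ 0)
    (hcx : ∀ i : Fin d, algebraMap K L (c i) = (prodInvPairs x).coeff (i + 1)) :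
    (palindromic c).map (algebraMap K L) = prodInvPairs x := by
  simp_rw [map_palindromic, hcx, ← prodInvPairs_eq_palindromic x hd hx]

end

end Polynomial

section

variable {k L : Type*} [Field k] [Field L] [Algebra k L] {d : ℕ} {x : Fin d → L}

theorem AlgebraicIndependent.zpow_eq_zpow_iff {ι : Type*} {x : ι → L}
    (hx : AlgebraicIndependent k x) {i j : ι} {e e' : ℤˣ} :
    x i ^ (e : ℤ) = x j ^ (e' : ℤ) ↔ i = j ∧ e = e' := by
  refine ⟨fun h => ?_, by rintro ⟨rfl, rfl⟩; rfl⟩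
  have h_mul {i j : ι} : x i * x j ≠ 1 := fun h => by
    have : (MvPolynomial.X i * MvPolynomial.X j : MvPolynomial ι k) = 1 :=
      algebraicIndependent_iff_injective_aeval.1 hx (by simpa using h)
    simpa using congrArg MvPolynomial.constantCoeff this
  rcases Int.units_eq_one_or e with rfl | rfl <;> rcases Int.units_eq_one_or e' with rfl | rfl
  · exact ⟨hx.injective (by simpa using h), rfl⟩
  · refine absurd ?_ (h_mul (i := i) (j := j))
    simp only [Units.val_one, zpow_one, Units.val_neg, zpow_neg] at h
    rw [h, inv_mul_cancel₀ (hx.ne_zero j)]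
  · refine absurd ?_ (h_mul (i := i) (j := j))
    simp only [Units.val_one, zpow_one, Units.val_neg, zpow_neg] at h
    rw [← h, mul_inv_cancel₀ (hx.ne_zero i)]
  · exact ⟨hx.injective (by simpa using h), rfl⟩

theorem AlgebraicIndependent.zpow_perm (hx : AlgebraicIndependent k x)
    (hx_top : IntermediateField.adjoin k (Set.range x) = ⊤) (π : Equiv.Perm (Fin d))
    (ε : Fin d → ℤˣ) : AlgebraicIndependent k fun i => x (π i) ^ (ε i : ℤ) := by
  refine hx.of_isAlgebraic_adjoin hx_top fun i => ?_
  have h := IntermediateField.subset_adjoin k _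
    (Set.mem_range_self (f := fun i => x (π i) ^ (ε i : ℤ)) (π.symm i))
  have h' := zpow_mem h (ε (π.symm i) : ℤ)
  rw [← zpow_mul, ← Units.val_mul, Int.units_mul_self, Units.val_one, zpow_one,
    π.apply_symm_apply] at h'
  exact isAlgebraic_algebraMap (⟨x i, h'⟩ : IntermediateField.adjoin k _)

theorem AlgebraicIndependent.coeff_prodInvPairs (hd : 1 ≤ d) (hx : AlgebraicIndependent k x)
    (hx_top : IntermediateField.adjoin k (Set.range x) = ⊤) :
    AlgebraicIndependent k fun i : Fin d => (prodInvPairs x).coeff (i + 1) := by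
  refine hx.of_isAlgebraic_adjoin hx_top fun i => ?_
  set c : Fin d → L := fun i => (prodInvPairs x).coeff (i + 1) with hc
  let c' : Fin d → IntermediateField.adjoin k (Set.range c) := fun i =>
    ⟨c i, IntermediateField.subset_adjoin k _ (Set.mem_range_self i)⟩
  have h_map : (palindromic c').map (algebraMap _ L) = prodInvPairs x :=
    map_palindromic_eq_prodInvPairs hd hx.ne_zero fun _ => rfl
  refine ⟨palindromic c', fun h => (monic_prodInvPairs x).ne_zero ?_, ?_⟩
  · rw [← h_map, h, Polynomial.map_zero]
  · rw [aeval_def, ← eval_map, h_map]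
    exact (isRoot_prodInvPairs_iff x).2 ⟨i, 1, by simp⟩

variable {K : Type*} [Field K] [Algebra k K] [Algebra K L] [IsScalarTower k K L]
  {c : Fin d → K}

theorem isSplittingField_palindromic (hd : 1 ≤ d) (hx : AlgebraicIndependent k x)
    (hx_top : IntermediateField.adjoin k (Set.range x) = ⊤)
    (hcx : ∀ i : Fin d, algebraMap K L (c i) = (prodInvPairs x).coeff (i + 1)) :
    (palindromic c).IsSplittingField K L := by
  have h_map := map_palindromic_eq_prodInvPairs hd hx.ne_zero hcx
  refine isSplittingField_iff_intermediateField.2 ⟨h_map ▸ splits_prodInvPairs x, ?_⟩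
  have h_le : (⊤ : IntermediateField k L) ≤
      (IntermediateField.adjoin K ((palindromic c).rootSet L)).restrictScalars k := by
    rw [← hx_top, IntermediateField.adjoin_le_iff]
    rintro _ ⟨i, rfl⟩
    refine IntermediateField.subset_adjoin K _ ?_
    rw [rootSet, aroots, h_map]
    simpa [(monic_prodInvPairs x).ne_zero] using (isRoot_prodInvPairs_iff x).2 ⟨i, 1, by simp⟩
  exact top_le_iff.1 fun a _ => h_le (IntermediateField.mem_top (x := a))

/-- The `K`-endomorphisms of `L` are exactly the maps `x i ↦ x (π i) ^ ε i` for permutations `π` and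
signs `ε`. -/
theorem card_algHom_eq (hd : 1 ≤ d) (hx : AlgebraicIndependent k x)
    (hx_top : IntermediateField.adjoin k (Set.range x) = ⊤)
    (hc_top : IntermediateField.adjoin k (Set.range c) = ⊤)
    (hcx : ∀ i : Fin d, algebraMap K L (c i) = (prodInvPairs x).coeff (i + 1)) :
    Nat.card (L →ₐ[K] L) = 2 ^ d * Nat.factorial d := by
  have h_ext {f g : L →ₐ[K] L} (h : ∀ i, f (x i) = g (x i)) : f = g := by
    have : f.restrictScalars k = g.restrictScalars k :=
      IntermediateField.algHom_ext_of_adjoin_eq_top hx_top (by rintro _ ⟨i, rfl⟩; exact h i)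
    exact AlgHom.ext fun a => DFunLike.congr_fun this a
  have h_exists (p : Equiv.Perm (Fin d) × (Fin d → ℤˣ)) :
      ∃ f : L →ₐ[K] L, ∀ i, f (x i) = x (p.1 i) ^ (p.2 i : ℤ) := by
    obtain ⟨f, hf⟩ := hx.exists_algHom_apply_eq hx_top (hx.zpow_perm hx_top p.1 p.2)
    have h_map := map_prodInvPairs_eq_self x (f := (f : L →+* L)) hf
    have h_comp : f.comp (IsScalarTower.toAlgHom k K L) = IsScalarTower.toAlgHom k K L := by
      refine IntermediateField.algHom_ext_of_adjoin_eq_top hc_top ?_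
      rintro _ ⟨i, rfl⟩
      change f (algebraMap K L (c i)) = algebraMap K L (c i)
      rw [hcx]
      conv_rhs => rw [← h_map, coeff_map]
      rfl
    exact ⟨{ (f : L →+* L) with commutes' := fun a => DFunLike.congr_fun h_comp a }, hf⟩
  choose Φ hΦ using h_exists
  have h_bij : Function.Bijective Φ := by
    constructor
    · rintro ⟨π, ε⟩ ⟨π', ε'⟩ h
      have h' (i : Fin d) : π i = π' i ∧ ε i = ε' i :=
        hx.zpow_eq_zpow_iff.1 ((hΦ (π, ε) i).symm.trans (h ▸ hΦ (π', ε') i))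
      exact Prod.ext (Equiv.ext fun i => (h' i).1) (funext fun i => (h' i).2)
    · intro f
      have h_map := map_palindromic_eq_prodInvPairs hd hx.ne_zero hcx
      have h_root (i : Fin d) : ∃ j, ∃ e : ℤˣ, f (x i) = x j ^ (e : ℤ) := by
        rw [← isRoot_prodInvPairs_iff, ← h_map, IsRoot, eval_map_algebraMap, aeval_algHom_apply,
          ← eval_map_algebraMap, h_map, (isRoot_prodInvPairs_iff x).2 ⟨i, 1, by simp⟩, map_zero]
      choose π ε hπ using h_root
      have h_inj : Function.Injective π := fun i j hij => by
        have h : f (x i ^ (ε i : ℤ)) = f (x j ^ (ε j : ℤ)) := by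
          rw [map_zpow₀, map_zpow₀, hπ, hπ, ← zpow_mul, ← zpow_mul, ← Units.val_mul,
            ← Units.val_mul, Int.units_mul_self, Int.units_mul_self, hij]
        exact (hx.zpow_eq_zpow_iff.1 (f.injective h)).1
      refine ⟨(Equiv.ofBijective π (Finite.injective_iff_bijective.1 h_inj), ε), h_ext fun i => ?_⟩
      rw [hΦ, hπ]
      rfl
  rw [← Nat.card_congr (Equiv.ofBijective Φ h_bij)]
  simp [Fintype.card_perm, mul_comm]

theorem card_gal_palindromic (hd : 1 ≤ d) (hx : AlgebraicIndependent k x)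
    (hx_top : IntermediateField.adjoin k (Set.range x) = ⊤)
    (hc_top : IntermediateField.adjoin k (Set.range c) = ⊤)
    (hcx : ∀ i : Fin d, algebraMap K L (c i) = (prodInvPairs x).coeff (i + 1)) :
    Nat.card (palindromic c).Gal = 2 ^ d * Nat.factorial d := by
  have := isSplittingField_palindromic (k := k) hd hx hx_top hcx
  have := IsSplittingField.finiteDimensional L (palindromic c)
  rw [← card_algHom_eq hd hx hx_top hc_top hcx,
    ← Nat.card_congr (Algebra.IsAlgebraic.algEquivEquivAlgHom K L).toEquiv]
  exact Nat.card_congr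
    (AlgEquiv.autCongr (IsSplittingField.algEquiv L (palindromic c))).symm.toEquiv

end

/-- The Galois group of the palindromic polynomial of degree `2 * d` whose `d` free coefficients are
algebraically independent generators of the base field has order `2 ^ d * d!`. -/
theorem card_gal_palindromic_of_algebraicIndependent {k K : Type*} [Field k] [Field K] [Algebra k K]
    {d : ℕ} (hd : 1 ≤ d) {c : Fin d → K} (hc : AlgebraicIndependent k c)
    (hc_top : IntermediateField.adjoin k (Set.range c) = ⊤) :
    Nat.card (palindromic c).Gal = 2 ^ d * Nat.factorial d := by
  obtain ⟨L, _, _, x, hx, hx_top⟩ : ∃ (L : Type _) (_ : Field L) (_ : Algebra k L) (x : Fin d → L),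
      AlgebraicIndependent k x ∧ IntermediateField.adjoin k (Set.range x) = ⊤ :=
    ⟨K, _, _, c, hc, hc_top⟩
  obtain ⟨f, hf⟩ := hc.exists_algHom_apply_eq hc_top (hx.coeff_prodInvPairs hd hx_top)
  let := (f : K →+* L).toAlgebra
  have : IsScalarTower k K L := .of_algebraMap_eq fun a => (f.commutes a).symm
  exact card_gal_palindromic hd hx hx_top hc_top hf

theorem MvPolynomial.adjoin_range_algebraMap_X_eq_top {k K ι : Type*} [Field k] [Field K]
    [Algebra (MvPolynomial ι k) K] [IsFractionRing (MvPolynomial ι k) K] [Algebra k K]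
    [IsScalarTower k (MvPolynomial ι k) K] :
    IntermediateField.adjoin k
      (Set.range fun i => algebraMap (MvPolynomial ι k) K (MvPolynomial.X i)) = ⊤ := by
  refine top_le_iff.1 fun a _ => ?_
  have h (p : MvPolynomial ι k) : algebraMap _ K p ∈ IntermediateField.adjoin k
      (Set.range fun i => algebraMap (MvPolynomial ι k) K (MvPolynomial.X i)) := by
    induction p using MvPolynomial.induction_on with
    | C r =>
      rw [← MvPolynomial.algebraMap_eq, ← IsScalarTower.algebraMap_apply]
      exact IntermediateField.algebraMap_mem _ r
    | add p q hp hq => rw [map_add]; exact add_mem hp hq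
    | mul_X p i hp =>
      rw [map_mul]
      exact mul_mem hp (IntermediateField.subset_adjoin k _ (Set.mem_range_self i))
  obtain ⟨p, q, -, rfl⟩ := IsFractionRing.div_surjective (MvPolynomial ι k) a
  exact div_mem (h p) (h q)

/-- The Galois group of the generic monic palindromic polynomial of degree `2d`,
`p = X^{2d} + c₁X^{2d−1} + ⋯ + c_{d−1}X^{d+1} + c_dX^d + c_{d−1}X^{d−1} + ⋯ + c₁X + 1`
over `K = ℂ(c₁, …, c_d)` (the coefficient of `X^i` equals that of `X^{2d−i}`),
has order `2^d · d!` (it is the wreath product `S₂ ≀ S_d`).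
Here `c i` denotes the parameter `c_{i+1}` of the paper, so the term for index `i`
is `c_{i+1}·(X^{i+1} + X^{2d−(i+1)})` for `i+1 < d` and `c_d·X^d` for `i+1 = d`. -/
theorem generic_palindromic_polynomial_gal_card (d : ℕ) (hd : 1 ≤ d) :
    let K := FractionRing (MvPolynomial (Fin d) ℂ)
    let c : Fin d → K := fun i => algebraMap (MvPolynomial (Fin d) ℂ) K (MvPolynomial.X i)
    let p : K[X] := X ^ (2 * d) + 1 +
      ∑ i : Fin d, C (c i) *
        (if (i : ℕ) + 1 = d then X ^ d
         else X ^ ((i : ℕ) + 1) + X ^ (2 * d - ((i : ℕ) + 1)))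
    Nat.card p.Gal = 2 ^ d * Nat.factorial d := by
  intro K c p
  refine card_gal_palindromic_of_algebraicIndependent (k := ℂ) hd ?_
    MvPolynomial.adjoin_range_algebraMap_X_eq_top
  exact (MvPolynomial.algebraicIndependent_X (Fin d) ℂ).map'
    (f := IsScalarTower.toAlgHom ℂ (MvPolynomial (Fin d) ℂ) K) (IsFractionRing.injective _ K)
end
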